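/- arXiv:1609.04241 — 8 statements merged into one kernel-verified Lean document; each statement's English description precedes it below -/
import Mathlib

section
/- Let F : A ⥤ B be a functor between categories that has both a left adjoint L : B ⥤ A and a right adjoint R : B ⥤ A. Then L is full and faithful if and only if R is full and faithful. -/
open CategoryTheory

/-- If a functor `F : A ⥤ B` has both a left adjoint `L` and a right adjoint `R`,
then `L` is full and faithful if and only if `R` is full and faithful. -/
theorem stmt_0 {A : Type*} {B : Type*} [Category A] [Category B]
    (F : A ⥤ B) (L R : B ⥤ A) (adjL : L ⊣ F) (adjR : F ⊣ R) :
    (L.Full ∧ L.Faithful) ↔ (R.Full ∧ R.Faithful) := by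
  let t : Adjunction.Triple L F R := ⟨adjL, adjR⟩
  constructor
  · rintro ⟨_, _⟩
    let h := t.fullyFaithfulEquiv (.ofFullyFaithful L)
    exact ⟨h.full, h.faithful⟩
  · rintro ⟨_, _⟩
    let h := t.fullyFaithfulEquiv.symm (.ofFullyFaithful R)
    exact ⟨h.full, h.faithful⟩
end

section
/- Under the reflective/coreflective setup, the endofunctor T ⋙ J (sending C to J(T C)) is left adjoint to the endofunctor S ⋙ I (sending C to I(S C)) as endofunctors of C. -/
open CategoryTheory

/-- Reflective/coreflective setup: `I : B ⥤ C` fully faithful with left adjoint `S`,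
`J : D ⥤ C` fully faithful with right adjoint `T`; assuming `I (S (ε c))` and
`J (T (α c))` are isomorphisms for all `c`, the endofunctor `T ⋙ J` of `C` is left
adjoint to the endofunctor `S ⋙ I`. -/
theorem stmt_1 {B C D : Type*} [Category B] [Category C] [Category D]
    (I : B ⥤ C) (S : C ⥤ B) (J : D ⥤ C) (T : C ⥤ D)
    [I.Full] [I.Faithful] [J.Full] [J.Faithful]
    (adjSI : S ⊣ I) (adjJT : J ⊣ T)
    (h1 : ∀ c : C, IsIso (I.map (S.map (adjJT.counit.app c))))
    (h2 : ∀ c : C, IsIso (J.map (T.map (adjSI.unit.app c)))) :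
    Nonempty ((T ⋙ J) ⊣ (S ⋙ I)) := by
  have hS (c : C) : IsIso (S.map (adjJT.counit.app c)) := isIso_of_reflects_iso _ I
  have hT (c : C) : IsIso (T.map (adjSI.unit.app c)) := isIso_of_reflects_iso _ J
  let adjDB : J ⋙ S ⊣ I ⋙ T := adjJT.comp adjSI
  have hunit (d : D) : IsIso (adjDB.unit.app d) := by
    simp only [adjDB, Adjunction.comp_unit_app]
    infer_instance
  have hcounit (b : B) : IsIso (adjDB.counit.app b) := by
    simp only [adjDB, Adjunction.comp_counit_app]
    infer_instance
  let adjBD : I ⋙ T ⊣ J ⋙ S := adjDB.toEquivalence.symm.toAdjunction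
  let isoT : S ⋙ (I ⋙ T) ≅ T :=
    (NatIso.ofComponents (F := T) (G := S ⋙ (I ⋙ T))
      (fun c => asIso (T.map (adjSI.unit.app c)))
      (fun f => (Functor.whiskerRight adjSI.unit T).naturality f)).symm
  let isoS : T ⋙ ((J ⋙ S) ⋙ I) ≅ S ⋙ I :=
    NatIso.ofComponents (fun c => asIso (I.map (S.map (adjJT.counit.app c))))
      (fun f => (Functor.whiskerRight adjJT.counit (S ⋙ I)).naturality f)
  let adjT : T ⊣ (J ⋙ S) ⋙ I := (adjSI.comp adjBD).ofNatIsoLeft isoT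
  exact ⟨(adjT.comp adjJT).ofNatIsoRight isoS⟩
end

section
/- Under the reflective/coreflective setup, the functor B ⥤ C sending b to J(T(I b)) is full and faithful, and the functor D ⥤ C sending d to I(S(J d)) is full and faithful. -/
open CategoryTheory

theorem stmt_3 {B C D : Type*} [Category B] [Category C] [Category D]
    (I : B ⥤ C) (S : C ⥤ B) (J : D ⥤ C) (T : C ⥤ D)
    [I.Full] [I.Faithful] [J.Full] [J.Faithful]
    (adjSI : S ⊣ I) (adjJT : J ⊣ T)
    (h1 : ∀ c : C, IsIso (I.map (S.map (adjJT.counit.app c))))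
    (h2 : ∀ c : C, IsIso (J.map (T.map (adjSI.unit.app c)))) :
    ((I ⋙ T ⋙ J).Full ∧ (I ⋙ T ⋙ J).Faithful) ∧
      ((J ⋙ S ⋙ I).Full ∧ (J ⋙ S ⋙ I).Faithful) := by
  have hS (c : C) : IsIso (S.map (adjJT.counit.app c)) :=
    isIso_of_reflects_iso _ I
  have hT (c : C) : IsIso (T.map (adjSI.unit.app c)) :=
    isIso_of_reflects_iso _ J
  let adj := adjJT.comp adjSI
  have hcounit (b : B) : IsIso (adj.counit.app b) := by
    rw [Adjunction.comp_counit_app]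
    infer_instance
  have hunit (d : D) : IsIso (adj.unit.app d) := by
    rw [Adjunction.comp_unit_app]
    infer_instance
  have : IsIso adj.counit := NatIso.isIso_of_isIso_app _
  have : IsIso adj.unit := NatIso.isIso_of_isIso_app _
  let hR := adj.fullyFaithfulROfIsIsoCounit.comp (Functor.FullyFaithful.ofFullyFaithful J)
  let hL := adj.fullyFaithfulLOfIsIsoUnit.comp (Functor.FullyFaithful.ofFullyFaithful I)
  exact ⟨⟨hR.full, hR.faithful⟩, hL.full, hL.faithful⟩
end

section
/- Under the reflective/coreflective setup, the functor I ⋙ T : B ⥤ D is left adjoint to the functor J ⋙ S : D ⥤ B, and moreover each of these two functors is an equivalence of categories. -/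
open CategoryTheory

/-- For a reflection `S ⊣ I` and a coreflection `J ⊣ T` such that `S` inverts the counit of
`J ⊣ T` and `T` inverts the unit of `S ⊣ I`, the composites `I ⋙ T` and `J ⋙ S` are mutually
inverse equivalences. -/
noncomputable def reflectiveCoreflectiveEquivalence {B C D : Type*}
    [Category B] [Category C] [Category D]
    {I : B ⥤ C} {S : C ⥤ B} {J : D ⥤ C} {T : C ⥤ D}
    [I.Full] [I.Faithful] [J.Full] [J.Faithful]
    (adjSI : S ⊣ I) (adjJT : J ⊣ T)
    [∀ c : C, IsIso (S.map (adjJT.counit.app c))]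
    [∀ c : C, IsIso (T.map (adjSI.unit.app c))] : B ≌ D :=
  CategoryTheory.Equivalence.mk (I ⋙ T) (J ⋙ S)
    (NatIso.ofComponents
      (fun b => (asIso (S.map (adjJT.counit.app (I.obj b))) ≪≫
        asIso (adjSI.counit.app b)).symm)
      (fun f => by
        simp only [Iso.symm_hom, Iso.comp_inv_eq, Iso.eq_inv_comp,
          ← Category.assoc]
        simp [← Functor.map_comp_assoc]))
    (NatIso.ofComponents
      (fun d => (asIso (adjJT.unit.app d) ≪≫
        asIso (T.map (adjSI.unit.app (J.obj d)))).symm)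
      (fun f => by
        simp only [Iso.symm_hom, Iso.comp_inv_eq, Iso.eq_inv_comp,
          ← Category.assoc]
        simp only [Iso.trans_hom, asIso_hom, Functor.comp_map, Functor.id_map, Category.assoc]
        rw [← T.map_comp, adjSI.unit_naturality, T.map_comp]
        exact adjJT.unit_naturality_assoc f _))

theorem stmt_4 {B C D : Type*} [Category B] [Category C] [Category D]
    (I : B ⥤ C) (S : C ⥤ B) (J : D ⥤ C) (T : C ⥤ D)
    [I.Full] [I.Faithful] [J.Full] [J.Faithful]
    (adjSI : S ⊣ I) (adjJT : J ⊣ T)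
    (h1 : ∀ c : C, IsIso (I.map (S.map (adjJT.counit.app c))))
    (h2 : ∀ c : C, IsIso (J.map (T.map (adjSI.unit.app c)))) :
    Nonempty ((I ⋙ T) ⊣ (J ⋙ S)) ∧ (I ⋙ T).IsEquivalence ∧ (J ⋙ S).IsEquivalence := by
  have (c : C) : IsIso (S.map (adjJT.counit.app c)) := isIso_of_reflects_iso _ I
  have (c : C) : IsIso (T.map (adjSI.unit.app c)) := isIso_of_reflects_iso _ J
  let e := reflectiveCoreflectiveEquivalence adjSI adjJT
  exact ⟨⟨e.toAdjunction⟩, e.isEquivalence_functor, e.isEquivalence_inverse⟩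
end

section
/- Let k be a field, n ≥ 1, and K = k[x]/(x^n). Then K is a cogenerator in the category of K-modules: for every K-module M and every nonzero element m ∈ M, there exists a K-linear map f : M → K with f(m) ≠ 0. -/
open Polynomial

/-- The truncated polynomial ring `k[x]/(xⁿ)`. -/
abbrev TruncatedPolynomial (k : Type*) [Field k] (n : ℕ) : Type _ :=
  k[X] ⧸ Ideal.span {(X : k[X]) ^ n}

namespace TruncatedPolynomial

variable {k : Type*} [Field k] {n : ℕ}

/-- The class of the variable in `k[x]/(xⁿ)`. -/
noncomputable def root (k : Type*) [Field k] (n : ℕ) : TruncatedPolynomial k n :=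
  Ideal.Quotient.mk _ X

theorem root_pow_self : root k n ^ n = 0 := by
  rw [root, ← map_pow, Ideal.Quotient.eq_zero_iff_mem]
  exact Ideal.mem_span_singleton_self _

theorem sum_smul_root_pow_ne_zero {c : ℕ → k} {i : ℕ} (hi : i < n) (hc : c i ≠ 0) :
    ∑ j ∈ Finset.range n, c j • root k n ^ j ≠ 0 := by
  have hmk : ∑ j ∈ Finset.range n, c j • root k n ^ j =
      Ideal.Quotient.mk (Ideal.span {(X : k[X]) ^ n})
        (∑ j ∈ Finset.range n, c j • (X : k[X]) ^ j) := by
    rw [map_sum]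
    rfl
  rw [hmk, Ne, Ideal.Quotient.eq_zero_iff_mem, Ideal.mem_span_singleton, X_pow_dvd_iff]
  intro h
  have h_coeff := h i hi
  simp [finsetSum_coeff, coeff_X_pow, hi] at h_coeff
  exact hc h_coeff

variable {M : Type*} [AddCommGroup M] [Module (TruncatedPolynomial k n) M] [Module k M]
  [IsScalarTower k (TruncatedPolynomial k n) M]

/-- A `k`-linear map commuting with multiplication by the variable is `k[x]/(xⁿ)`-linear. -/
theorem map_smul_of_map_root_smul {N : Type*} [AddCommGroup N]
    [Module (TruncatedPolynomial k n) N] [Module k N] [IsScalarTower k (TruncatedPolynomial k n) N]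
    (g : M →ₗ[k] N) (hg : ∀ v, g (root k n • v) = root k n • g v)
    (a : TruncatedPolynomial k n) (v : M) : g (a • v) = a • g v := by
  have h_pow (i : ℕ) (v : M) : g (root k n ^ i • v) = root k n ^ i • g v := by
    induction i generalizing v with
    | zero => simp
    | succ i ih => rw [pow_succ, mul_smul, ih, hg, mul_smul]
  obtain ⟨p, rfl⟩ := Ideal.Quotient.mk_surjective a
  induction p using Polynomial.induction_on' with
  | add p q hp hq => rw [map_add, add_smul, map_add, hp, hq, add_smul]
  | monomial i c =>
    have h_mk : Ideal.Quotient.mk (Ideal.span {(X : k[X]) ^ n}) (monomial i c) =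
        c • root k n ^ i := by
      rw [← smul_X_eq_monomial]
      rfl
    rw [h_mk, smul_assoc, map_smul, h_pow, smul_assoc]

/-- The `k`-linear map `v ↦ ∑ φ(x^{n-1-i} v) xⁱ` attached to a `k`-linear functional `φ`. -/
noncomputable def coinduce (φ : M →ₗ[k] k) : M →ₗ[k] TruncatedPolynomial k n where
  toFun v := ∑ i ∈ Finset.range n, φ (root k n ^ (n - 1 - i) • v) • root k n ^ i
  map_add' v w := by simp only [smul_add, map_add, add_smul, Finset.sum_add_distrib]
  map_smul' c v := by
    rw [RingHom.id_apply, Finset.smul_sum]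
    refine Finset.sum_congr rfl fun i _ => ?_
    rw [← algebraMap_smul (TruncatedPolynomial k n) c v, smul_comm, algebraMap_smul, map_smul,
      smul_assoc]

theorem coinduce_apply (φ : M →ₗ[k] k) (v : M) :
    (coinduce φ v : TruncatedPolynomial k n) =
      ∑ i ∈ Finset.range n, φ (root k n ^ (n - 1 - i) • v) • root k n ^ i :=
  rfl

theorem coinduce_root_smul (φ : M →ₗ[k] k) (v : M) :
    (coinduce φ (root k n • v) : TruncatedPolynomial k n) = root k n • coinduce φ v := by
  rw [coinduce_apply, coinduce_apply]
  cases n with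
  | zero => simp
  | succ n =>
    rw [Finset.sum_range_succ', Finset.sum_range_succ, smul_add, Finset.smul_sum]
    congr 1
    · refine Finset.sum_congr rfl fun i hi => ?_
      have h_exp : n + 1 - 1 - i = n + 1 - 1 - (i + 1) + 1 := by
        have := Finset.mem_range.mp hi
        omega
      rw [h_exp, pow_succ (root k (n + 1)) (n + 1 - 1 - (i + 1)), mul_smul, pow_succ' _ i,
        smul_comm (root k (n + 1)), smul_eq_mul]
    · have h_zero : root k (n + 1) ^ (n + 1 - 1 - 0) • root k (n + 1) • v = 0 := by
        rw [← mul_smul, ← pow_succ, Nat.add_sub_cancel, Nat.sub_zero, root_pow_self]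
        exact zero_smul (TruncatedPolynomial k (n + 1)) v
      have h_top : root k (n + 1) • root k (n + 1) ^ n = 0 := by
        rw [smul_eq_mul, ← pow_succ', root_pow_self]
      rw [h_zero, map_zero, zero_smul, smul_comm (root k (n + 1)), h_top, smul_zero]

theorem coinduce_ne_zero (hn : 1 ≤ n) {φ : M →ₗ[k] k} {v : M} (hφ : φ v ≠ 0) :
    (coinduce φ v : TruncatedPolynomial k n) ≠ 0 := by
  rw [coinduce_apply]
  exact sum_smul_root_pow_ne_zero (c := fun i => φ (root k n ^ (n - 1 - i) • v))
    (Nat.sub_lt hn one_pos) (by simpa using hφ)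

end TruncatedPolynomial

/-- For a field `k` and `n ≥ 1`, the ring `K = k[x]/(xⁿ)` is a cogenerator in the
category of `K`-modules: every nonzero element of a `K`-module is detected by a
`K`-linear functional into `K`. -/
theorem stmt_9 (k : Type*) [Field k] (n : ℕ) (hn : 1 ≤ n)
    (M : Type*) [AddCommGroup M]
    [Module (Polynomial k ⧸ Ideal.span {(Polynomial.X : Polynomial k) ^ n}) M]
    (m : M) (hm : m ≠ 0) :
    ∃ f : M →ₗ[Polynomial k ⧸ Ideal.span {(Polynomial.X : Polynomial k) ^ n}]
        (Polynomial k ⧸ Ideal.span {(Polynomial.X : Polynomial k) ^ n}),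
      f m ≠ 0 := by
  let : Module k M := Module.compHom M (algebraMap k (TruncatedPolynomial k n))
  have : IsScalarTower k (TruncatedPolynomial k n) M :=
    ⟨fun c a v => (congrArg (· • v) (Algebra.smul_def c a)).trans (mul_smul _ _ _)⟩
  obtain ⟨φ, hφ⟩ : ∃ φ : M →ₗ[k] k, φ m ≠ 0 := by
    by_contra! h
    exact hm ((Module.forall_dual_apply_eq_zero_iff k m).mp h)
  exact ⟨{ TruncatedPolynomial.coinduce φ with
    map_smul' := TruncatedPolynomial.map_smul_of_map_root_smul _
      (TruncatedPolynomial.coinduce_root_smul φ) },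
    TruncatedPolynomial.coinduce_ne_zero hn hφ⟩
end

section
/- (Ingleton's theorem) Let K be a spherically complete nonarchimedean normed field, E a normed K-vector space whose norm is nonarchimedean (‖x + y‖ ≤ max(‖x‖, ‖y‖)), and V a subspace of E. For every K-linear functional φ : V → K and every constant M ≥ 0 with ‖φ(v)‖ ≤ M·‖v‖ for all v ∈ V, there exists a K-linear functional ψ : E → K whose restriction to V is φ and with ‖ψ(x)‖ ≤ M·‖x‖ for all x ∈ E. -/
/-- A metric space is spherically complete if every nonempty family of closed balls
that is totally ordered by inclusion has nonempty intersection. -/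
def IsSphericallyComplete (K : Type*) [PseudoMetricSpace K] : Prop :=
  ∀ B : Set (Set K), B.Nonempty →
    (∀ b ∈ B, ∃ (c : K) (r : ℝ), 0 ≤ r ∧ b = Metric.closedBall c r) →
    IsChain (· ⊆ ·) B → (⋂₀ B).Nonempty

open LinearPMap in
/-- One-step extension: a bounded functional with values in a spherically complete field
that is not everywhere defined extends to a strictly larger subspace with the same bound. -/
theorem IsSphericallyComplete.exists_lt_of_domain_ne_top {K : Type*} [NormedField K]
    [IsUltrametricDist K] (hsc : IsSphericallyComplete K)
    {E : Type*} [NormedAddCommGroup E] [NormedSpace K E] [IsUltrametricDist E]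
    {M : ℝ} (hM : 0 ≤ M) (f : E →ₗ.[K] K) (hf : ∀ v : f.domain, ‖f v‖ ≤ M * ‖(v : E)‖)
    (hdom : f.domain ≠ ⊤) :
    ∃ g, f < g ∧ ∀ v : g.domain, ‖g v‖ ≤ M * ‖(v : E)‖ := by
  obtain ⟨y, -, hy⟩ : ∃ y ∈ ⊤, y ∉ f.domain := SetLike.exists_of_lt (lt_top_iff_ne_top.2 hdom)
  let b : f.domain → Set K := fun v ↦ Metric.closedBall (f v) (M * ‖(v : E) - y‖)
  have hb : ∀ v w : f.domain, ‖(v : E) - y‖ ≤ ‖(w : E) - y‖ → b v ⊆ b w := by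
    intro v w hvw
    have hmem : f v ∈ Metric.closedBall (f w) (M * ‖(w : E) - y‖) := by
      rw [mem_closedBall_iff_norm, ← f.map_sub]
      refine (hf _).trans (mul_le_mul_of_nonneg_left ?_ hM)
      have h := IsUltrametricDist.norm_add_le_max ((v : E) - y) (-((w : E) - y))
      rw [← sub_eq_add_neg, sub_sub_sub_cancel_right, norm_neg, max_eq_right hvw] at h
      exact h
    change _ ⊆ Metric.closedBall _ _
    rw [IsUltrametricDist.closedBall_eq_of_mem hmem]
    exact Metric.closedBall_subset_closedBall (mul_le_mul_of_nonneg_left hvw hM)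
  obtain ⟨c, hc⟩ : (⋂₀ Set.range b).Nonempty := by
    refine hsc _ (Set.range_nonempty b) ?_ ?_
    · rintro _ ⟨v, rfl⟩
      exact ⟨_, _, by positivity, rfl⟩
    · rintro _ ⟨v, rfl⟩ _ ⟨w, rfl⟩ -
      exact (le_total ‖(v : E) - y‖ ‖(w : E) - y‖).imp (hb v w) (hb w v)
  have hc' : ∀ v : f.domain, ‖c - f v‖ ≤ M * ‖(v : E) - y‖ := fun v ↦
    mem_closedBall_iff_norm.1 (hc _ ⟨v, rfl⟩)
  refine ⟨f.supSpanSingleton y c hy, ?_, ?_⟩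
  · refine lt_iff_le_not_ge.2 ⟨f.left_le_sup _ _, fun H ↦ ?_⟩
    replace H := LinearPMap.domain_mono.monotone H
    rw [domain_supSpanSingleton, sup_le_iff, Submodule.span_le, Set.singleton_subset_iff] at H
    exact hy H.2
  · rintro ⟨z, hz⟩
    rcases Submodule.mem_sup.1 hz with ⟨x, hx, y', hy', rfl⟩
    rcases Submodule.mem_span_singleton.1 hy' with ⟨r, rfl⟩
    rw [supSpanSingleton_apply_mk _ _ _ _ _ hx]
    rcases eq_or_ne r 0 with rfl | hr
    · simpa using hf ⟨x, hx⟩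
    · have h := mul_le_mul_of_nonneg_left (hc' (-r⁻¹ • ⟨x, hx⟩)) (norm_nonneg r)
      rw [mul_left_comm, ← norm_mul, ← norm_smul, f.map_smul] at h
      have h₁ : r * (c - -r⁻¹ • f ⟨x, hx⟩) = f ⟨x, hx⟩ + r • c := by
        simp only [smul_eq_mul]
        field_simp
        ring
      have h₂ : r • (((-r⁻¹ • ⟨x, hx⟩ : f.domain) : E) - y) = -(x + r • y) := by
        rw [Submodule.coe_smul, smul_sub, smul_smul, mul_neg, mul_inv_cancel₀ hr, neg_one_smul]
        abel
      rw [h₁, h₂, norm_neg] at h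
      exact h

/-- A bounded partially defined functional with values in a spherically complete field extends
to an everywhere defined one with the same bound. -/
theorem IsSphericallyComplete.exists_ge_domain_eq_top {K : Type*} [NormedField K]
    [IsUltrametricDist K] (hsc : IsSphericallyComplete K)
    {E : Type*} [NormedAddCommGroup E] [NormedSpace K E] [IsUltrametricDist E]
    {M : ℝ} (hM : 0 ≤ M) (f : E →ₗ.[K] K) (hf : ∀ v : f.domain, ‖f v‖ ≤ M * ‖(v : E)‖) :
    ∃ g, f ≤ g ∧ g.domain = ⊤ ∧ ∀ v : g.domain, ‖g v‖ ≤ M * ‖(v : E)‖ := by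
  let S : Set (E →ₗ.[K] K) := {g | ∀ v : g.domain, ‖g v‖ ≤ M * ‖(v : E)‖}
  have hS : ∀ c, c ⊆ S → IsChain (· ≤ ·) c → ∀ g ∈ c, ∃ ub ∈ S, ∀ z ∈ c, z ≤ ub := by
    intro c hcS hc g hg
    refine ⟨LinearPMap.sSup c hc.directedOn, ?_, fun _ ↦ LinearPMap.le_sSup hc.directedOn⟩
    rintro ⟨x, hx⟩
    obtain ⟨l, hl, hxl⟩ := (LinearPMap.mem_domain_sSup_iff ⟨g, hg⟩ hc.directedOn).1 hx
    have h := LinearPMap.sSup_apply hc.directedOn hl ⟨x, hxl⟩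
    exact (congrArg norm h).trans_le (hcS hl ⟨x, hxl⟩)
  obtain ⟨q, hfq, hqS, hq⟩ := zorn_le_nonempty₀ S hS f hf
  refine ⟨q, hfq, ?_, hqS⟩
  by_contra hdom
  obtain ⟨r, hqr, hr⟩ := hsc.exists_lt_of_domain_ne_top hM q hqS hdom
  exact hqr.not_ge (hq hr hqr.le)

/-- Ingleton's theorem: over a spherically complete nonarchimedean normed field `K`,
every bounded linear functional on a subspace `V` of a nonarchimedean normed
`K`-vector space `E` extends to `E` with the same bound. -/
theorem stmt_10 (K : Type*) [NormedField K]
    (hK : ∀ x y : K, ‖x + y‖ ≤ max ‖x‖ ‖y‖)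
    (hsc : IsSphericallyComplete K)
    (E : Type*) [NormedAddCommGroup E] [NormedSpace K E]
    (hE : ∀ x y : E, ‖x + y‖ ≤ max ‖x‖ ‖y‖)
    (V : Subspace K E) (φ : V →ₗ[K] K) (M : ℝ) (hM : 0 ≤ M)
    (hφ : ∀ v : V, ‖φ v‖ ≤ M * ‖(v : E)‖) :
    ∃ ψ : E →ₗ[K] K, (∀ v : V, ψ v = φ v) ∧ ∀ x : E, ‖ψ x‖ ≤ M * ‖x‖ := by
  have := IsUltrametricDist.isUltrametricDist_of_forall_norm_add_le_max_norm hK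
  have := IsUltrametricDist.isUltrametricDist_of_forall_norm_add_le_max_norm hE
  obtain ⟨⟨W, g⟩, hle, hW, hg⟩ := hsc.exists_ge_domain_eq_top hM ⟨V, φ⟩ hφ
  obtain rfl : W = ⊤ := hW
  refine ⟨g ∘ₗ Submodule.topEquiv.symm.toLinearMap, fun v ↦ ?_, fun x ↦ hg ⟨x, trivial⟩⟩
  exact (hle.2 (x := v) (y := ⟨v, trivial⟩) rfl).symm
end

section
/- A locally compact nonarchimedean normed field with nontrivial norm is spherically complete: if K is a nonarchimedean normed field that is locally compact as a topological space and whose norm takes some value other than 0 and 1, then every nonempty family of closed balls in K that is totally ordered by inclusion has nonempty intersection. -/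
/-- A locally compact nonarchimedean normed field with nontrivial norm is spherically
complete: every nonempty family of closed balls that is totally ordered by inclusion
has nonempty intersection. -/
theorem stmt_11 (K : Type*) [NormedField K]
    (hK : ∀ x y : K, ‖x + y‖ ≤ max ‖x‖ ‖y‖)
    [LocallyCompactSpace K]
    (hnt : ∃ x : K, ‖x‖ ≠ 0 ∧ ‖x‖ ≠ 1) :
    ∀ B : Set (Set K), B.Nonempty →
      (∀ b ∈ B, ∃ (c : K) (r : ℝ), 0 ≤ r ∧ b = Metric.closedBall c r) →
      IsChain (· ⊆ ·) B → (⋂₀ B).Nonempty := by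
  intro B hB hball hchain
  obtain ⟨x, hx0, hx1⟩ := hnt
  let _ : NontriviallyNormedField K :=
    NontriviallyNormedField.ofNormNeOne ⟨x, norm_ne_zero_iff.mp hx0, hx1⟩
  have : ProperSpace K := ProperSpace.of_locallyCompactSpace K
  have : Nonempty B := hB.to_subtype
  have hdir : DirectedOn (· ⊇ ·) B := fun s hs t ht =>
    (hchain.total hs ht).elim (fun h => ⟨s, hs, subset_rfl, h⟩) (fun h => ⟨t, ht, h, subset_rfl⟩)
  refine IsCompact.nonempty_sInter_of_directed_nonempty_isCompact_isClosed hdir ?_ ?_ ?_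
  all_goals
    intro b hb
    obtain ⟨c, r, hr, rfl⟩ := hball b hb
  · exact Metric.nonempty_closedBall.mpr hr
  · exact isCompact_closedBall c r
  · exact Metric.isClosed_closedBall
end

section
/- Let K be a spherically complete nonarchimedean normed field, (E_i)_{i ∈ I} a family of nonarchimedean normed K-vector spaces, and V a K-subspace of the product ∏_{i ∈ I} E_i, equipped with the subspace topology of the product topology. Then every continuous K-linear functional φ : V → K extends to a continuous K-linear functional ψ : ∏_{i ∈ I} E_i → K. -/
/-- In a spherically complete ultrametric space, closed balls of nonnegative radii any two of which
satisfy `dist (c i) (c j) ≤ max (r i) (r j)` have a common point. -/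
theorem IsSphericallyComplete.exists_forall_dist_le {X : Type*} [PseudoMetricSpace X]
    [IsUltrametricDist X] (hX : IsSphericallyComplete X) {α : Type*} [Nonempty α]
    (c : α → X) (r : α → ℝ) (hr : ∀ i, 0 ≤ r i)
    (hcr : ∀ i j, dist (c i) (c j) ≤ max (r i) (r j)) :
    ∃ a, ∀ i, dist a (c i) ≤ r i := by
  have subset_of_le : ∀ i j, r i ≤ r j →
      Metric.closedBall (c i) (r i) ⊆ Metric.closedBall (c j) (r j) := fun i j hij x hx ↦
    (dist_triangle_max x (c i) (c j)).trans
      (max_le ((Metric.mem_closedBall.1 hx).trans hij) ((hcr i j).trans (max_le hij le_rfl)))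
  obtain ⟨a, ha⟩ := hX (Set.range fun i ↦ Metric.closedBall (c i) (r i)) (Set.range_nonempty _)
    (by rintro _ ⟨i, rfl⟩; exact ⟨c i, r i, hr i, rfl⟩)
    (by
      rintro _ ⟨i, rfl⟩ _ ⟨j, rfl⟩ -
      exact (le_total (r i) (r j)).imp (subset_of_le i j) (subset_of_le j i))
  exact ⟨a, fun i ↦ ha _ ⟨i, rfl⟩⟩

section HahnBanach

variable {K X : Type*} [NormedField K] [AddCommGroup X] [Module K X]

/-- One-dimensional extension step in Ingleton's theorem. -/
theorem IsSphericallyComplete.exists_lt_linearPMap [IsUltrametricDist K]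
    (hK : IsSphericallyComplete K) (p : Seminorm K X) (hp : IsNonarchimedean p)
    (f : X →ₗ.[K] K) (hf : ∀ x : f.domain, ‖f x‖ ≤ p x) (hdom : f.domain ≠ ⊤) :
    ∃ g, f < g ∧ ∀ x : g.domain, ‖g x‖ ≤ p x := by
  obtain ⟨y, -, hy⟩ : ∃ y ∈ ⊤, y ∉ f.domain := SetLike.exists_of_lt (lt_top_iff_ne_top.2 hdom)
  obtain ⟨a, ha⟩ := hK.exists_forall_dist_le (fun x : f.domain ↦ f x) (fun x ↦ p (x - y))
    (fun _ ↦ apply_nonneg _ _) fun v w ↦ by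
      have h : ((v - w : f.domain) : X) = (v - y) + -(w - y) := by
        rw [Submodule.coe_sub]; abel
      rw [dist_eq_norm, ← f.map_sub, ← map_neg_eq_map p ((w : X) - y)]
      exact (hf _).trans (h ▸ hp _ _)
  refine ⟨f.supSpanSingleton y a hy, ?_, ?_⟩
  · refine lt_iff_le_not_ge.2 ⟨f.left_le_sup _ _, fun H ↦ ?_⟩
    replace H := LinearPMap.domain_mono.monotone H
    rw [LinearPMap.domain_supSpanSingleton, sup_le_iff, Submodule.span_le,
      Set.singleton_subset_iff] at H
    exact hy H.2
  · rintro ⟨z, hz⟩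
    rcases Submodule.mem_sup.1 hz with ⟨x, hx, y', hy', rfl⟩
    rcases Submodule.mem_span_singleton.1 hy' with ⟨r, rfl⟩
    rw [LinearPMap.supSpanSingleton_apply_mk _ _ _ _ _ hx, RingHom.id_apply, smul_eq_mul]
    rcases eq_or_ne r 0 with rfl | hr
    · simpa using hf ⟨x, hx⟩
    · have h := ha ((-r⁻¹) • ⟨x, hx⟩)
      rw [f.map_smul, Submodule.coe_smul, dist_eq_norm] at h
      have h₁ : f ⟨x, hx⟩ + r * a = r * (a - (-r⁻¹) • f ⟨x, hx⟩) := by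
        rw [smul_eq_mul]; field_simp; ring
      have h₂ : x + r • y = (-r) • ((-r⁻¹) • x - y) := by
        rw [smul_sub, smul_smul, neg_mul_neg, mul_inv_cancel₀ hr, one_smul, neg_smul,
          sub_neg_eq_add]
      change _ ≤ p (x + r • y)
      rw [h₁, h₂, norm_mul, map_smul_eq_mul, norm_neg]
      exact mul_le_mul_of_nonneg_left h (norm_nonneg r)

/-- **Ingleton's theorem**: over a spherically complete nonarchimedean field, a linear functional
on a subspace dominated by a nonarchimedean seminorm extends to the whole space with the same
domination. -/
theorem IsSphericallyComplete.exists_extension_of_le_seminorm [IsUltrametricDist K]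
    (hK : IsSphericallyComplete K) (p : Seminorm K X) (hp : IsNonarchimedean p)
    (f : X →ₗ.[K] K) (hf : ∀ x : f.domain, ‖f x‖ ≤ p x) :
    ∃ g : X →ₗ[K] K, (∀ x : f.domain, g x = f x) ∧ ∀ x, ‖g x‖ ≤ p x := by
  set S := {g : X →ₗ.[K] K | ∀ x : g.domain, ‖g x‖ ≤ p x}
  have hSc : ∀ c, c ⊆ S → IsChain (· ≤ ·) c → ∀ y ∈ c, ∃ ub ∈ S, ∀ z ∈ c, z ≤ ub := by
    intro c hcs c_chain y hy
    have hcd : DirectedOn (· ≤ ·) c := c_chain.directedOn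
    refine ⟨LinearPMap.sSup c hcd, ?_, fun _ ↦ LinearPMap.le_sSup hcd⟩
    rintro ⟨x, hx⟩
    have hdir : DirectedOn (· ≤ ·) (LinearPMap.domain '' c) :=
      directedOn_image.2 (hcd.mono LinearPMap.domain_mono.monotone)
    rcases (Submodule.mem_sSup_of_directed (Set.Nonempty.image _ ⟨y, hy⟩) hdir).1 hx with
      ⟨_, ⟨g, hgc, rfl⟩, hgx⟩
    have hle : g ≤ LinearPMap.sSup c hcd := LinearPMap.le_sSup _ hgc
    have heq : g ⟨x, hgx⟩ = LinearPMap.sSup c hcd ⟨x, hx⟩ := hle.2 rfl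
    rw [← heq]
    exact hcs hgc ⟨x, hgx⟩
  obtain ⟨q, hfq, hqs, hq⟩ := zorn_le_nonempty₀ S hSc f hf
  have hdom : q.domain = ⊤ := by
    by_contra h
    obtain ⟨r, hqr, hr⟩ := hK.exists_lt_linearPMap p hp q hqs h
    exact hqr.not_ge (hq hr hqr.le)
  have hmem : ∀ x, x ∈ q.domain := fun x ↦ hdom ▸ Submodule.mem_top
  exact ⟨q.toFun.comp (LinearMap.id.codRestrict q.domain hmem), fun x ↦ (hfq.2 rfl).symm,
    fun x ↦ hqs ⟨x, hmem x⟩⟩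

end HahnBanach

/-- A continuous linear functional on a subspace of a product of nonarchimedean normed spaces is
dominated by a continuous nonarchimedean seminorm on the product. -/
theorem Submodule.exists_seminorm_pi_of_continuous {K : Type*} [NormedField K]
    {ι : Type*} {E : ι → Type*} [∀ i, NormedAddCommGroup (E i)] [∀ i, NormedSpace K (E i)]
    (hE : ∀ i, ∀ x y : E i, ‖x + y‖ ≤ max ‖x‖ ‖y‖)
    (V : Submodule K (∀ i, E i)) (φ : V →ₗ[K] K) (hφ : Continuous φ) :
    ∃ p : Seminorm K (∀ i, E i), Continuous p ∧ IsNonarchimedean p ∧ ∀ v : V, ‖φ v‖ ≤ p v := by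
  have hU : {v : V | ‖φ v‖ < 1} ∈ nhds (0 : V) :=
    (isOpen_lt hφ.norm continuous_const).mem_nhds (by simp)
  obtain ⟨U, hU₀, hUφ⟩ := mem_nhds_subtype _ _ _ |>.1 hU
  rw [Submodule.coe_zero, nhds_pi, Filter.mem_pi] at hU₀
  obtain ⟨F, hF, t, ht, htU⟩ := hU₀
  choose ε hε hεt using fun i ↦ Metric.mem_nhds_iff.1 (ht i)
  let q (i : ι) : Seminorm K (∀ i, E i) :=
    (NNReal.mk (ε i)⁻¹ (inv_pos.2 (hε i)).le) •
      (normSeminorm K (E i)).comp (LinearMap.proj i)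
  have hq : ∀ i x, q i x = (ε i)⁻¹ * ‖x i‖ := fun i x ↦ rfl
  let p := hF.toFinset.sup q
  have hqc : ∀ i, Continuous (q i) := fun i ↦ by
    change Continuous fun x : ∀ i, E i ↦ (ε i)⁻¹ * ‖x i‖
    fun_prop
  have hφp : ∀ v : V, p v < 1 → ‖φ v‖ < 1 := by
    refine fun v hv ↦ hUφ (htU fun i hi ↦ hεt i ?_)
    have h : q i v < 1 := (Seminorm.le_finset_sup_apply (hF.mem_toFinset.2 hi)).trans_lt hv
    rw [hq, inv_mul_lt_one₀ (hε i)] at h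
    simpa using h
  refine ⟨p, Seminorm.continuous_finsetSup fun i _ ↦ hqc i, fun x y ↦ ?_, fun v ↦ ?_⟩
  · refine Seminorm.finset_sup_apply_le (le_max_of_le_left (apply_nonneg p x)) fun i hi ↦ ?_
    calc q i (x + y) ≤ (ε i)⁻¹ * max ‖x i‖ ‖y i‖ :=
          mul_le_mul_of_nonneg_left (hE i _ _) (inv_pos.2 (hε i)).le
      _ = max (q i x) (q i y) := mul_max_of_nonneg _ _ (inv_pos.2 (hε i)).le
      _ ≤ max (p x) (p y) :=
          max_le_max (Seminorm.le_finset_sup_apply hi) (Seminorm.le_finset_sup_apply hi)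
  · by_contra! h
    have hpos : 0 < ‖φ v‖ := (apply_nonneg p _).trans_lt h
    have := hφp ((φ v)⁻¹ • v) (by
      rwa [Submodule.coe_smul, map_smul_eq_mul, norm_inv, inv_mul_lt_one₀ hpos])
    rw [map_smul, smul_eq_mul, inv_mul_cancel₀ (norm_pos_iff.1 hpos), norm_one] at this
    exact this.false

/-- Let `K` be a spherically complete nonarchimedean normed field and `(E i)` a family
of nonarchimedean normed `K`-vector spaces.  Every continuous linear functional on a
subspace `V` of the product `∀ i, E i` (with the subspace topology of the product
topology) extends to a continuous linear functional on the whole product. -/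
theorem stmt_17 (K : Type*) [NormedField K]
    (hK : ∀ x y : K, ‖x + y‖ ≤ max ‖x‖ ‖y‖)
    (hsc : IsSphericallyComplete K)
    {ι : Type*} (E : ι → Type*)
    [∀ i, NormedAddCommGroup (E i)] [∀ i, NormedSpace K (E i)]
    (hE : ∀ i, ∀ x y : E i, ‖x + y‖ ≤ max ‖x‖ ‖y‖)
    (V : Submodule K (∀ i, E i)) (φ : V →ₗ[K] K) (hφ : Continuous φ) :
    ∃ ψ : (∀ i, E i) →ₗ[K] K, Continuous ψ ∧ ∀ v : V, ψ v = φ v := by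
  have : IsUltrametricDist K :=
    IsUltrametricDist.isUltrametricDist_of_forall_norm_add_le_max_norm hK
  obtain ⟨p, hpc, hp, hφp⟩ := V.exists_seminorm_pi_of_continuous hE φ hφ
  obtain ⟨ψ, hψφ, hψp⟩ := hsc.exists_extension_of_le_seminorm p hp ⟨V, φ⟩ hφp
  refine ⟨ψ, continuous_of_continuousAt_zero ψ ?_, hψφ⟩
  rw [ContinuousAt, map_zero]
  exact squeeze_zero_norm hψp (by simpa using hpc.tendsto 0)
end
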